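/- arXiv:1712.00896 — 2 statements merged into one kernel-verified Lean document; each statement's English description precedes it below -/
import Mathlib

section
/- Let b ∈ ℂ and let v₀ = x_{n₁}^{i₁}⋯x_{n_k}^{i_k} be a monomial with all n_j ≠ m. Then for every i ∈ ℤ, in N: Ẽ21(m)(Ẽ12(−m)(x_m^{−i} v₀)) = −x_m^{−i+1}·𝓔_m(v₀) + (i + b)(2(i₁+⋯+i_k) − b − μ − i − 1)·q^{−m₁m₂}·x_m^{−i} v₀. -/
open MvPolynomial Finsupp

/-- The index set of the variables other than `x_m`. -/
abbrev NVar (m : ℤ × ℤ) := {p : ℤ × ℤ // p ≠ m}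

/-- `N = ℂ[x_m, x_m^{−1}][x_n : n ≠ m]`, realized as finitely supported families,
indexed by the exponent of `x_m` (an arbitrary integer), of polynomials in the
variables `x_n`, `n ≠ m`. -/
abbrev NN (m : ℤ × ℤ) := ℤ →₀ MvPolynomial (NVar m) ℂ

/-- Multiplication by `x_m^j` on `N` (for `j = -1` this is `X_m^{−1}`). -/
noncomputable def XmZ (m : ℤ × ℤ) (j : ℤ) (g : NN m) : NN m :=
  Finsupp.mapDomain (· + j) g

/-- Multiplication by `x_k` on `N` (the operator `X_k`). -/
noncomputable def Xop (m : ℤ × ℤ) (k : ℤ × ℤ) (g : NN m) : NN m :=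
  if h : k = m then XmZ m 1 g
  else Finsupp.mapRange (fun a => X (⟨k, h⟩ : NVar m) * a) (by simp) g

/-- The partial derivative `∂_s` on `N` (with `∂_m x_m^k = k x_m^{k−1}`, `k ∈ ℤ`). -/
noncomputable def Dop (m : ℤ × ℤ) (s : ℤ × ℤ) (g : NN m) : NN m :=
  if h : s = m then g.sum (fun k a => Finsupp.single (k - 1) (k • a))
  else Finsupp.mapRange (fun a => pderiv (⟨s, h⟩ : NVar m) a) (by simp) g

/-- A finite set of indices containing every `s` for which `∂_s` acts nonzero on `g`
(together with `m`); sums over all `s ∈ ℤ²` in the defining formulas reduce to sums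
over this finite set. -/
noncomputable def nvars (m : ℤ × ℤ) (g : NN m) : Finset (ℤ × ℤ) :=
  insert m (g.support.biUnion fun k => (g k).vars.image Subtype.val)

/-- `E21(n)` on `N`: multiplication by `x_n`. -/
noncomputable def E21N (m n : ℤ × ℤ) (g : NN m) : NN m := Xop m n g

/-- `E22(n) = Σ_s q^{s₁n₂} x_{n+s} ∂_s` on `N`. -/
noncomputable def E22N (q : ℂ) (m n : ℤ × ℤ) (g : NN m) : NN m :=
  ∑ s ∈ nvars m g, q ^ (s.1 * n.2) • Xop m (n + s) (Dop m s g)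

/-- `E11(n) = δ_{n,0} μ id − Σ_s q^{s₂n₁} x_{n+s} ∂_s` on `N`. -/
noncomputable def E11N (q μ : ℂ) (m n : ℤ × ℤ) (g : NN m) : NN m :=
  (if n = 0 then μ • g else 0) - ∑ s ∈ nvars m g, q ^ (s.2 * n.1) • Xop m (n + s) (Dop m s g)

/-- `E12(n) = q^{−n₁n₂} μ ∂_{−n} − Σ_{s,r} q^{n₂r₁+s₂n₁+s₂r₁} x_{n+s+r} ∂_s ∂_r` on `N`. -/
noncomputable def E12N (q μ : ℂ) (m n : ℤ × ℤ) (g : NN m) : NN m :=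
  q ^ (-(n.1 * n.2)) • μ • Dop m (-n) g -
    ∑ s ∈ nvars m g, ∑ r ∈ nvars m g,
      q ^ (n.2 * r.1 + s.2 * n.1 + s.2 * r.1) • Xop m (n + s + r) (Dop m s (Dop m r g))

/-- `𝓔_m = Σ_{s,r} q^{−m₂r₁−s₂m₁+s₂r₁} x_{−m+s+r} ∂_s ∂_r` on `N`. -/
noncomputable def EmN (q : ℂ) (m : ℤ × ℤ) (g : NN m) : NN m :=
  ∑ s ∈ nvars m g, ∑ r ∈ nvars m g,
    q ^ (-(m.2 * r.1) - s.2 * m.1 + s.2 * r.1) • Xop m (-m + s + r) (Dop m s (Dop m r g))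

/-- `D1 = Σ_s s₁ x_s ∂_s` on `N`. -/
noncomputable def D1N (m : ℤ × ℤ) (g : NN m) : NN m :=
  ∑ s ∈ nvars m g, (s.1 : ℂ) • Xop m s (Dop m s g)

/-- `D2 = Σ_s s₂ x_s ∂_s` on `N`. -/
noncomputable def D2N (m : ℤ × ℤ) (g : NN m) : NN m :=
  ∑ s ∈ nvars m g, (s.2 : ℂ) • Xop m s (Dop m s g)

/-- The `b`-twisted operator `Ẽ12(n)` on `N`. -/
noncomputable def tE12 (q μ : ℂ) (m : ℤ × ℤ) (b : ℂ) (n : ℤ × ℤ) (g : NN m) : NN m :=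
  E12N q μ m n g
    + b • (q ^ (m.2 * n.1) • E22N q m (m + n) (XmZ m (-1) g)
           - q ^ (m.1 * n.2) • E11N q μ m (m + n) (XmZ m (-1) g))
    - (b * (b - 1) * q ^ (m.2 * n.1 + m.2 * m.1 + m.1 * n.2)) •
        Xop m (m + m + n) (XmZ m (-1) (XmZ m (-1) g))

/-- The `b`-twisted operator `Ẽ11(n)` on `N`. -/
noncomputable def tE11 (q μ : ℂ) (m : ℤ × ℤ) (b : ℂ) (n : ℤ × ℤ) (g : NN m) : NN m :=
  E11N q μ m n g + (b * q ^ (m.2 * n.1)) • Xop m (m + n) (XmZ m (-1) g)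

/-- The `b`-twisted operator `Ẽ22(n)` on `N`. -/
noncomputable def tE22 (q : ℂ) (m : ℤ × ℤ) (b : ℂ) (n : ℤ × ℤ) (g : NN m) : NN m :=
  E22N q m n g - (b * q ^ (m.1 * n.2)) • Xop m (m + n) (XmZ m (-1) g)

/-- The `b`-twisted operator `D̃1 = D1 − b m₁ id` on `N`. -/
noncomputable def tD1 (m : ℤ × ℤ) (b : ℂ) (g : NN m) : NN m := D1N m g - (b * (m.1 : ℂ)) • g

/-- The `b`-twisted operator `D̃2 = D2 − b m₂ id` on `N`. -/
noncomputable def tD2 (m : ℤ × ℤ) (b : ℂ) (g : NN m) : NN m := D2N m g - (b * (m.2 : ℂ)) • g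

section

variable (m : ℤ × ℤ)

lemma XmZ_single (j k : ℤ) (p : MvPolynomial (NVar m) ℂ) :
    XmZ m j (Finsupp.single k p) = Finsupp.single (k + j) p :=
  Finsupp.mapDomain_single

lemma XmZ_add (j : ℤ) (f g : NN m) : XmZ m j (f + g) = XmZ m j f + XmZ m j g :=
  Finsupp.mapDomain_add

lemma XmZ_neg (j : ℤ) (f : NN m) : XmZ m j (-f) = -XmZ m j f :=
  map_neg (Finsupp.mapDomain.addMonoidHom (· + j)) f

lemma XmZ_smul (j : ℤ) (c : ℂ) (f : NN m) : XmZ m j (c • f) = c • XmZ m j f :=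
  Finsupp.mapDomain_smul c f

lemma XmZ_sum {ι : Type*} (j : ℤ) (s : Finset ι) (f : ι → NN m) :
    XmZ m j (∑ a ∈ s, f a) = ∑ a ∈ s, XmZ m j (f a) :=
  Finsupp.mapDomain_finsetSum

lemma XmZ_XmZ (j k : ℤ) (f : NN m) : XmZ m j (XmZ m k f) = XmZ m (k + j) f := by
  simp only [XmZ, ← Finsupp.mapDomain_comp]
  congr 1
  funext x
  simp [add_assoc]

lemma Xop_self (f : NN m) : Xop m m f = XmZ m 1 f := by
  simp [Xop]

lemma Xop_single_of_ne (v : NVar m) (k : ℤ) (p : MvPolynomial (NVar m) ℂ) :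
    Xop m v (Finsupp.single k p) = Finsupp.single k (X v * p) := by
  rw [Xop, dif_neg v.2, Finsupp.mapRange_single]

lemma Dop_self_single (k : ℤ) (p : MvPolynomial (NVar m) ℂ) :
    Dop m m (Finsupp.single k p) = (k : ℂ) • Finsupp.single (k - 1) p := by
  rw [Dop, dif_pos rfl, Finsupp.sum_single_index (by simp), Finsupp.smul_single,
    Int.cast_smul_eq_zsmul]

lemma Dop_single_of_ne (v : NVar m) (k : ℤ) (p : MvPolynomial (NVar m) ℂ) :
    Dop m v (Finsupp.single k p) = Finsupp.single k (pderiv v p) := by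
  rw [Dop, dif_neg v.2, Finsupp.mapRange_single]

lemma Xop_single_eq_XmZ (n : ℤ × ℤ) (k : ℤ) (p : MvPolynomial (NVar m) ℂ) :
    Xop m n (Finsupp.single k p) = XmZ m k (Xop m n (Finsupp.single 0 p)) := by
  by_cases h : n = m
  · subst h
    simp [Xop_self, XmZ_single, add_comm]
  · lift n to NVar m using h
    simp only [Xop_single_of_ne, XmZ_single, zero_add]

lemma Xop_smul (n : ℤ × ℤ) (c : ℂ) (f : NN m) : Xop m n (c • f) = c • Xop m n f := by
  by_cases h : n = m
  · simp [Xop, h, XmZ_smul]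
  · ext1 k
    simp [Xop, h]

lemma Dop_smul_single (s : ℤ × ℤ) (c : ℂ) (k : ℤ) (p : MvPolynomial (NVar m) ℂ) :
    Dop m s (c • Finsupp.single k p) = c • Dop m s (Finsupp.single k p) := by
  rw [Finsupp.smul_single]
  by_cases h : s = m
  · subst h
    rw [Dop_self_single, Dop_self_single, ← Finsupp.smul_single, smul_comm]
  · lift s to NVar m using h
    simp [Dop_single_of_ne]

/-- A sum over `nvars` of a one-term element splits off the contribution of `x_m`. -/
lemma sum_nvars_single {M : Type*} [AddCommMonoid M] {k : ℤ} {p : MvPolynomial (NVar m) ℂ}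
    (f : ℤ × ℤ → M) :
    ∑ s ∈ nvars m (Finsupp.single k p), f s = f m + ∑ v ∈ p.vars, f v := by
  have hn : nvars m (Finsupp.single k p) = insert m (p.vars.image Subtype.val) := by
    by_cases hp : p = 0
    · simp [nvars, hp]
    · simp [nvars, Finsupp.support_single k hp]
  rw [hn, Finset.sum_insert, Finset.sum_image Subtype.val_injective.injOn]
  simp

lemma sum_Xop_Dop_single {d : ℂ} {p : MvPolynomial (NVar m) ℂ}
    (hp : ∑ v ∈ p.vars, X v * pderiv v p = d • p) (k : ℤ) :
    ∑ v ∈ p.vars, Xop m v (Dop m v (Finsupp.single k p)) = d • Finsupp.single k p := by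
  simp only [Dop_single_of_ne, Xop_single_of_ne, Finsupp.smul_single]
  rw [← hp]
  exact (map_sum (Finsupp.singleAddHom k) _ _).symm

lemma E22N_zero_single (q : ℂ) {d : ℂ} {p : MvPolynomial (NVar m) ℂ}
    (hp : ∑ v ∈ p.vars, X v * pderiv v p = d • p) (k : ℤ) :
    E22N q m 0 (Finsupp.single k p) = (k + d) • Finsupp.single k p := by
  simp only [E22N, sum_nvars_single, Prod.snd_zero, mul_zero, zpow_zero, one_smul, zero_add,
    sum_Xop_Dop_single m hp, Dop_self_single, Xop_self, XmZ_smul, XmZ_single, sub_add_cancel,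
    add_smul]

lemma E11N_zero_single (q μ : ℂ) {d : ℂ} {p : MvPolynomial (NVar m) ℂ}
    (hp : ∑ v ∈ p.vars, X v * pderiv v p = d • p) (k : ℤ) :
    E11N q μ m 0 (Finsupp.single k p) = (μ - (k + d)) • Finsupp.single k p := by
  rw [sub_smul, ← E22N_zero_single m q hp]
  simp [E11N, E22N]

/-- The part of `𝓔_m` that does not differentiate in `x_m`. -/
noncomputable def EmCore (q : ℂ) (k : ℤ) (p : MvPolynomial (NVar m) ℂ) : NN m :=
  ∑ s ∈ p.vars, ∑ r ∈ p.vars,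
    q ^ (-(m.2 * r.1.1) - s.1.2 * m.1 + s.1.2 * r.1.1) •
      Xop m (-m + s + r) (Dop m s (Dop m r (Finsupp.single k p)))

lemma EmCore_eq_XmZ (q : ℂ) (k : ℤ) (p : MvPolynomial (NVar m) ℂ) :
    EmCore m q k p = XmZ m k (EmCore m q 0 p) := by
  simp only [EmCore, XmZ_sum, XmZ_smul, Dop_single_of_ne]
  simp only [Xop_single_eq_XmZ m _ k]

lemma EmN_single (q : ℂ) {d : ℂ} {p : MvPolynomial (NVar m) ℂ}
    (hp : ∑ v ∈ p.vars, X v * pderiv v p = d • p) (k : ℤ) :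
    EmN q m (Finsupp.single k p) =
      (q ^ (-(m.1 * m.2)) * (k * (k - 1 + 2 * d))) • Finsupp.single (k - 1) p
        + EmCore m q k p := by
  have h1 (r : ℤ × ℤ) : -m + m + r = r := by simp
  have h2 (r : ℤ × ℤ) : -m + r + m = r := by abel
  have e1 (x : ℤ) : -(m.2 * x) - m.2 * m.1 + m.2 * x = -(m.1 * m.2) := by ring
  have e2 (x : ℤ) : -(m.2 * m.1) - x * m.1 + x * m.1 = -(m.1 * m.2) := by ring
  have hc (v : NVar m) : Dop m m (Dop m v (Finsupp.single k p))
      = (k : ℂ) • Dop m v (Finsupp.single (k - 1) p) := by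
    simp only [Dop_single_of_ne, Dop_self_single]
  simp only [EmN, sum_nvars_single, h1, h2, e1, e2, Finset.sum_add_distrib, hc, Xop_smul,
    Dop_self_single, Dop_smul_single, Xop_self, XmZ_smul, XmZ_single, ← Finset.smul_sum,
    sum_Xop_Dop_single m hp, EmCore]
  rw [← add_assoc, sub_add_cancel]
  congr 1
  push_cast
  module

lemma E12N_neg (q μ : ℂ) (f : NN m) :
    E12N q μ m (-m) f = (q ^ (-(m.1 * m.2)) * μ) • Dop m m f - EmN q m f := by
  simp only [E12N, EmN, neg_neg, Prod.fst_neg, Prod.snd_neg, mul_smul, neg_mul, mul_neg,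
    ← sub_eq_add_neg]

end

lemma sum_X_mul_pderiv_monomial {σ : Type*} (e : σ →₀ ℕ) :
    ∑ v ∈ (monomial e (1 : ℂ)).vars, X v * pderiv v (monomial e (1 : ℂ))
      = (e.degree : ℂ) • monomial e (1 : ℂ) := by
  simp only [vars_monomial one_ne_zero, X_mul_pderiv_monomial, ← Finset.sum_smul,
    Finsupp.degree_apply, Nat.cast_smul_eq_nsmul]

lemma sum_X_mul_pderiv_prod_X_pow {ι σ : Type*} [Fintype ι] (n : ι → σ) (a : ι → ℕ) :
    ∑ v ∈ (∏ j, X (R := ℂ) (n j) ^ a j).vars, X v * pderiv v (∏ j, X (R := ℂ) (n j) ^ a j)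
      = (∑ j, (a j : ℂ)) • ∏ j, X (R := ℂ) (n j) ^ a j := by
  have h : ∏ j, X (R := ℂ) (n j) ^ a j = monomial (∑ j, Finsupp.single (n j) (a j)) 1 := by
    simp only [monomial_sum_one, X_pow_eq_monomial]
  rw [h, sum_X_mul_pderiv_monomial]
  simp [map_sum]

/-- the formula for `Ẽ21(m)(Ẽ12(−m)(x_m^{−i} v₀))`, where
`v₀ = x_{n₁}^{i₁}⋯x_{n_K}^{i_K}` is a monomial in variables `≠ m` and `i ∈ ℤ`
(note `Ẽ21(m) = E21(m)`). -/
theorem stmt16 (q μ : ℂ) (hq : q ≠ 0) (m : ℤ × ℤ) (b : ℂ)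
    (K : ℕ) (ns : Fin K → NVar m) (is : Fin K → ℕ) (i : ℤ) :
    E21N m m (tE12 q μ m b (-m) (Finsupp.single (-i) (∏ j, X (ns j) ^ is j))) =
      -(XmZ m (-i + 1) (EmN q m (Finsupp.single 0 (∏ j, X (ns j) ^ is j))))
      + (((i : ℂ) + b) * (2 * (∑ j, (is j : ℂ)) - b - μ - (i : ℂ) - 1) *
            q ^ (-(m.1 * m.2))) •
          Finsupp.single (-i) (∏ j, X (ns j) ^ is j) := by
  have hp := sum_X_mul_pderiv_prod_X_pow ns is
  generalize (∏ j, X (R := ℂ) (ns j) ^ is j) = p at hp ⊢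
  generalize (∑ j, (is j : ℂ)) = d at hp ⊢
  have h1 : m.2 * (-m).1 = -(m.1 * m.2) := by simp [mul_comm]
  have h2 : m.1 * (-m).2 = -(m.1 * m.2) := by simp
  have h3 : -(m.1 * m.2) + m.2 * m.1 + -(m.1 * m.2) = -(m.1 * m.2) := by ring
  have h0 : EmN q m (Finsupp.single 0 p) = EmCore m q 0 p := by
    simp [EmN_single m q hp]
  have h4 : -i - 1 + 1 = -i := by ring
  have h5 : -i + -1 + 1 = -i := by ring
  have h6 : -i + -1 + -1 + 1 + 1 = -i := by ring
  simp only [tE12, h1, h2, h3, h0, E12N_neg, EmN_single m q hp, E21N, Xop_self,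
    XmZ_single, Dop_self_single, add_neg_cancel, add_neg_cancel_right,
    E22N_zero_single m q hp, E11N_zero_single m q μ hp, EmCore_eq_XmZ m q (-i),
    sub_eq_add_neg (G := NN m), XmZ_add, XmZ_neg, XmZ_smul, XmZ_XmZ, h4, h5, h6, neg_add]
  push_cast
  module
end

section
/- Let b ∈ ℂ, d ∈ ℤ, p ∈ ℤ, and for i ∈ ℕ set B_i = (i + b − p)(2d − b − μ − 1 − i − p)·q^{−m₁m₂}. Suppose w ∈ N satisfies (Ẽ11(0) − Ẽ22(0))(w) = (μ − 2d + 2b)·w and Ẽ12(−m)(w) = B₀·X_m^{−1}(w). Then for every k ∈ ℕ, Ẽ12(−m)^k(w) = B₀B₁⋯B_{k−1}·X_m^{−k}(w). -/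
open MvPolynomial Finsupp

section TwistedOperators

variable {m : ℤ × ℤ}

lemma XmZ_apply (j : ℤ) (g : NN m) (k : ℤ) : XmZ m j g k = g (k - j) := by
  have h := Finsupp.mapDomain_apply (add_left_injective j) g (k - j)
  simpa [XmZ] using h

lemma Dop_self_apply (g : NN m) (k : ℤ) : Dop m m g k = (k + 1) • g (k + 1) := by
  rw [Dop, dif_pos rfl, Finsupp.sum_apply, Finsupp.sum_eq_single (k + 1)]
  · simp
  · intro i _ hi
    rw [Finsupp.single_apply, if_neg]
    omega
  · simp

/-- `XmZ` as a linear map. -/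
noncomputable def XmZLin (m : ℤ × ℤ) (j : ℤ) : NN m →ₗ[ℂ] NN m where
  toFun := XmZ m j
  map_add' f g := by ext1 k; simp [XmZ_apply]
  map_smul' c g := by ext1 k; simp [XmZ_apply]

/-- `Xop` as a linear map. -/
noncomputable def XopLin (m k : ℤ × ℤ) : NN m →ₗ[ℂ] NN m where
  toFun := Xop m k
  map_add' f g := by
    by_cases h : k = m
    · simp only [Xop, dif_pos h]; exact map_add (XmZLin m 1) f g
    · ext1 i; simp [Xop, h, mul_add]
  map_smul' c g := by
    by_cases h : k = m
    · simp only [Xop, dif_pos h]; exact map_smul (XmZLin m 1) c g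
    · ext1 i; simp [Xop, h]

/-- `Dop` as a linear map. -/
noncomputable def DopLin (m s : ℤ × ℤ) : NN m →ₗ[ℂ] NN m where
  toFun := Dop m s
  map_add' f g := by
    by_cases h : s = m
    · subst h; ext1 i; simp [Dop_self_apply]
    · ext1 i; simp [Dop, h]
  map_smul' c g := by
    by_cases h : s = m
    · subst h; ext1 i; simp [Dop_self_apply]
    · ext1 i; simp [Dop, h]

lemma XmZ_eq_XmZLin (j : ℤ) : XmZ m j = XmZLin m j := rfl

lemma Xop_eq_XopLin (k : ℤ × ℤ) : Xop m k = XopLin m k := rfl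

lemma Dop_eq_DopLin (s : ℤ × ℤ) : Dop m s = DopLin m s := rfl

lemma XopLin_self_XmZLin (g : NN m) : XopLin m m (XmZLin m (-1) g) = g := by
  ext1 k
  rw [← XmZ_eq_XmZLin, ← Xop_eq_XopLin, Xop, dif_pos rfl, XmZ_apply, XmZ_apply]
  congr 1
  ring

lemma XopLin_XmZLin (k : ℤ × ℤ) (j : ℤ) (g : NN m) :
    XopLin m k (XmZLin m j g) = XmZLin m j (XopLin m k g) := by
  ext1 i
  simp only [← XmZ_eq_XmZLin, ← Xop_eq_XopLin]
  by_cases h : k = m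
  · simp only [Xop, dif_pos h, XmZ_apply]
    congr 1
    ring
  · simp [Xop, h, XmZ_apply]

lemma DopLin_XmZLin (s : ℤ × ℤ) (g : NN m) :
    DopLin m s (XmZLin m (-1) g) = XmZLin m (-1) (DopLin m s g) -
      if s = m then XmZLin m (-1) (XmZLin m (-1) g) else 0 := by
  ext1 i
  simp only [← XmZ_eq_XmZLin, ← Dop_eq_DopLin]
  by_cases h : s = m
  · subst h
    simp only [if_true, Finsupp.sub_apply, Dop_self_apply, XmZ_apply, sub_neg_eq_add]
    module
  · simp [Dop, h, XmZ_apply]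

lemma nvars_XmZLin (g : NN m) : nvars m (XmZLin m (-1) g) = nvars m g := by
  ext s
  simp only [nvars, Finset.mem_insert, Finset.mem_biUnion, Finsupp.mem_support_iff,
    ← XmZ_eq_XmZLin, XmZ_apply]
  refine or_congr_right ⟨fun ⟨k, hk⟩ => ⟨_, hk⟩, fun ⟨k, hk⟩ => ⟨k - 1, ?_⟩⟩
  simpa using hk

lemma nvars_smul {c : ℂ} (hc : c ≠ 0) (g : NN m) : nvars m (c • g) = nvars m g := by
  ext s
  simp only [nvars, Finsupp.support_smul_eq hc, Finsupp.smul_apply, smul_eq_C_mul,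
    vars_C_mul _ hc]

lemma self_mem_nvars (g : NN m) : m ∈ nvars m g := Finset.mem_insert_self _ _

/-- The Euler operator `Σ_s x_s ∂_s` restricted to the variables in `S`. -/
noncomputable def eulerLin (m : ℤ × ℤ) (S : Finset (ℤ × ℤ)) : NN m →ₗ[ℂ] NN m :=
  ∑ s ∈ S, XopLin m s ∘ₗ DopLin m s

/-- The operator `𝓔_m` restricted to the variables in `S`. -/
noncomputable def EmLin (q : ℂ) (m : ℤ × ℤ) (S : Finset (ℤ × ℤ)) : NN m →ₗ[ℂ] NN m :=
  ∑ s ∈ S, ∑ r ∈ S, q ^ (-(m.2 * r.1) - s.2 * m.1 + s.2 * r.1) •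
    (XopLin m (-m + s + r) ∘ₗ DopLin m s ∘ₗ DopLin m r)

/-- The operator `Ẽ12(-m)` restricted to the variables in `S`. -/
noncomputable def tE12Lin (q μ : ℂ) (m : ℤ × ℤ) (b : ℂ) (S : Finset (ℤ × ℤ)) :
    NN m →ₗ[ℂ] NN m :=
  (q ^ (-(m.1 * m.2)) * μ) • DopLin m m - EmLin q m S +
    (b * q ^ (-(m.1 * m.2))) • ((2 : ℂ) • eulerLin m S - μ • LinearMap.id) ∘ₗ XmZLin m (-1) -
    (b * (b - 1) * q ^ (-(m.1 * m.2))) • XmZLin m (-1)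

lemma eulerLin_XmZLin {S : Finset (ℤ × ℤ)} (hS : m ∈ S) (g : NN m) :
    eulerLin m S (XmZLin m (-1) g) = XmZLin m (-1) (eulerLin m S g) - XmZLin m (-1) g := by
  simp only [eulerLin, LinearMap.sum_apply, LinearMap.comp_apply, DopLin_XmZLin, map_sub,
    Finset.sum_sub_distrib, map_sum, XopLin_XmZLin, apply_ite (XopLin m _), map_zero,
    Finset.sum_ite_eq', hS, if_true]
  rw [← XopLin_XmZLin, XopLin_self_XmZLin]

lemma DopLin_DopLin_XmZLin (s r : ℤ × ℤ) (g : NN m) :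
    DopLin m s (DopLin m r (XmZLin m (-1) g)) =
      XmZLin m (-1) (DopLin m s (DopLin m r g))
      - (if s = m then XmZLin m (-1) (XmZLin m (-1) (DopLin m r g)) else 0)
      - (if r = m then XmZLin m (-1) (XmZLin m (-1) (DopLin m s g)) else 0)
      + (if s = m then if r = m then
          (2 : ℂ) • XmZLin m (-1) (XmZLin m (-1) (XmZLin m (-1) g)) else 0 else 0) := by
  by_cases hs : s = m <;> by_cases hr : r = m <;>
    simp only [hs, hr, if_true, if_false, DopLin_XmZLin, map_sub, sub_zero, add_zero]
  module

lemma EmLin_XmZLin (q : ℂ) {S : Finset (ℤ × ℤ)} (hS : m ∈ S) (g : NN m) :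
    EmLin q m S (XmZLin m (-1) g) = XmZLin m (-1) (EmLin q m S g) -
      (2 * q ^ (-(m.1 * m.2))) • XmZLin m (-1) (XmZLin m (-1) (eulerLin m S g)) +
      (2 * q ^ (-(m.1 * m.2))) • XmZLin m (-1) (XmZLin m (-1) g) := by
  have h1 : ∀ r : ℤ × ℤ, -(m.2 * r.1) - m.2 * m.1 + m.2 * r.1 = -(m.1 * m.2) := fun r => by ring
  have h2 : ∀ s : ℤ × ℤ, -(m.2 * m.1) - s.2 * m.1 + s.2 * m.1 = -(m.1 * m.2) := fun s => by ring
  have h3 : ∀ s : ℤ × ℤ, -m + s + m = s := fun s => by abel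
  simp only [EmLin, eulerLin, LinearMap.sum_apply, LinearMap.smul_apply, LinearMap.comp_apply,
    DopLin_DopLin_XmZLin, map_sub, map_add, smul_sub, smul_add, Finset.sum_sub_distrib,
    Finset.sum_add_distrib, apply_ite (XopLin m _), map_zero, smul_ite, smul_zero,
    Finset.sum_ite_irrel, Finset.sum_const_zero, Finset.sum_ite_eq', hS, if_true, h1, h2, h3,
    neg_add_cancel, zero_add, XopLin_XmZLin, map_sum, map_smul, ← Finset.smul_sum]
  rw [← XopLin_XmZLin m (-1) g, XopLin_self_XmZLin]
  module

lemma tE12Lin_XmZLin (q μ b : ℂ) {S : Finset (ℤ × ℤ)} (hS : m ∈ S) (g : NN m) :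
    tE12Lin q μ m b S (XmZLin m (-1) g) = XmZLin m (-1) (tE12Lin q μ m b S g) +
      q ^ (-(m.1 * m.2)) • XmZLin m (-1) (XmZLin m (-1)
        ((2 : ℂ) • eulerLin m S g - (μ + 2 + 2 * b) • g)) := by
  simp only [tE12Lin, LinearMap.sub_apply, LinearMap.add_apply, LinearMap.smul_apply,
    LinearMap.comp_apply, LinearMap.id_apply, EmLin_XmZLin q hS, eulerLin_XmZLin hS,
    DopLin_XmZLin, if_true, map_sub, map_add, map_smul]
  module

lemma tE12_neg_self (q μ b : ℂ) (g : NN m) :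
    tE12 q μ m b (-m) g = tE12Lin q μ m b (nvars m g) g := by
  have h1 : ∀ r s : ℤ × ℤ, -m.2 * r.1 + s.2 * -m.1 + s.2 * r.1 =
    -(m.2 * r.1) - s.2 * m.1 + s.2 * r.1 := fun r s => by ring
  have h2 : m.2 * -m.1 + m.2 * m.1 + m.1 * -m.2 = -(m.1 * m.2) := by ring
  have h3 : m.2 * -m.1 = -(m.1 * m.2) := by ring
  have h4 : m.1 * -m.2 = -(m.1 * m.2) := by ring
  simp only [tE12, E12N, E22N, E11N, tE12Lin, EmLin, eulerLin, XmZ_eq_XmZLin, Xop_eq_XopLin,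
    Dop_eq_DopLin, nvars_XmZLin, LinearMap.sub_apply, LinearMap.add_apply, LinearMap.smul_apply,
    LinearMap.comp_apply, LinearMap.id_apply, LinearMap.sum_apply, Prod.fst_neg, Prod.snd_neg,
    neg_neg, neg_mul_neg, h1, h2, add_neg_cancel, Prod.fst_zero, Prod.snd_zero, mul_zero,
    zpow_zero, one_smul, zero_add, if_true, add_neg_cancel_right, XopLin_self_XmZLin]
  rw [h3, h4]
  module

lemma tE12_neg_self_smul (q μ b c : ℂ) (g : NN m) :
    tE12 q μ m b (-m) (c • g) = c • tE12 q μ m b (-m) g := by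
  rw [tE12_neg_self, tE12_neg_self]
  rcases eq_or_ne c 0 with rfl | hc
  · simp only [zero_smul, map_zero]
  · rw [nvars_smul hc, map_smul]

lemma tE11_zero_sub_tE22_zero (q μ b : ℂ) (g : NN m) :
    tE11 q μ m b 0 g - tE22 q m b 0 g =
      (μ + 2 * b) • g - (2 : ℂ) • eulerLin m (nvars m g) g := by
  simp only [tE11, tE22, E11N, E22N, eulerLin, XmZ_eq_XmZLin, Xop_eq_XopLin, Dop_eq_DopLin,
    LinearMap.sum_apply, LinearMap.comp_apply, Prod.fst_zero, Prod.snd_zero, mul_zero, zpow_zero,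
    one_smul, zero_add, add_zero, if_true, mul_one, XopLin_self_XmZLin]
  module

end TwistedOperators

/-- if `(Ẽ11(0) − Ẽ22(0))(w) = (μ−2d+2b) w` and
`Ẽ12(−m)(w) = B₀ X_m^{−1}(w)`, where `B_i = (i+b−p)(2d−b−μ−1−i−p) q^{−m₁m₂}`, then
`Ẽ12(−m)^k(w) = B₀B₁⋯B_{k−1} X_m^{−k}(w)` for every `k`. -/
theorem stmt18 (q μ : ℂ) (hq : q ≠ 0) (m : ℤ × ℤ) (b : ℂ) (d p : ℤ) (w : NN m)
    (B : ℕ → ℂ)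
    (hB : ∀ i : ℕ, B i = ((i : ℂ) + b - (p : ℂ)) *
      (2 * (d : ℂ) - b - μ - 1 - (i : ℂ) - (p : ℂ)) * q ^ (-(m.1 * m.2)))
    (hw1 : tE11 q μ m b 0 w - tE22 q m b 0 w = (μ - 2 * (d : ℂ) + 2 * b) • w)
    (hw2 : tE12 q μ m b (-m) w = B 0 • XmZ m (-1) w) :
    ∀ k : ℕ, (tE12 q μ m b (-m))^[k] w = (∏ i ∈ Finset.range k, B i) • (XmZ m (-1))^[k] w := by
  have hnv : ∀ k : ℕ, nvars m ((XmZ m (-1))^[k] w) = nvars m w := by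
    intro k
    induction k with
    | zero => rfl
    | succ k ih => rw [Function.iterate_succ_apply', XmZ_eq_XmZLin, nvars_XmZLin, ← ih]; rfl
  have heuler : ∀ k : ℕ, eulerLin m (nvars m w) ((XmZ m (-1))^[k] w) =
      ((d : ℂ) - k) • (XmZ m (-1))^[k] w := by
    intro k
    induction k with
    | zero =>
      rw [tE11_zero_sub_tE22_zero] at hw1
      have h2 : (2 : ℂ) • eulerLin m (nvars m w) w = (2 : ℂ) • ((d : ℂ) • w) := by
        rw [← sub_eq_zero] at hw1 ⊢
        rw [← neg_eq_zero, ← hw1]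
        module
      simpa using smul_right_injective _ (two_ne_zero' ℂ) h2
    | succ k ih =>
      rw [Function.iterate_succ_apply', XmZ_eq_XmZLin, eulerLin_XmZLin (self_mem_nvars w),
        ← XmZ_eq_XmZLin, ih, XmZ_eq_XmZLin, map_smul]
      push_cast
      module
  have hstep : ∀ k : ℕ, tE12Lin q μ m b (nvars m w) ((XmZ m (-1))^[k] w) =
      B k • (XmZ m (-1))^[k + 1] w := by
    intro k
    induction k with
    | zero => rw [tE12_neg_self] at hw2; simpa using hw2
    | succ k ih =>
      simp only [Function.iterate_succ_apply'] at ih ⊢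
      rw [XmZ_eq_XmZLin, tE12Lin_XmZLin q μ b (self_mem_nvars w), ← XmZ_eq_XmZLin, ih, heuler,
        XmZ_eq_XmZLin]
      simp only [map_sub, map_smul, hB]
      push_cast
      module
  intro k
  induction k with
  | zero => simp
  | succ k ih =>
    rw [Function.iterate_succ_apply', ih, tE12_neg_self_smul, tE12_neg_self, hnv, hstep,
      smul_smul, Finset.prod_range_succ]
end
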